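/- arXiv:math/0312146 — 3 statements merged into one kernel-verified Lean document; each statement's English description precedes it below -/
import Mathlib

section
/- Let g be a finite-dimensional real Lie algebra with Killing form B, and let g = k ⊕ m be a direct sum decomposition into subspaces satisfying [k,k] ⊆ k, [m,m] ⊆ k, [k,m] ⊆ m. Suppose {X_i} (i = 1,…,n) is a basis of m with B(X_i, X_j) = δ_{ij} and {X_α} (α = n+1,…,n+r) is a basis of k with B(X_α, X_β) = −δ_{αβ}. Then for all x, y ∈ m, Σ_α B([X_α, x], [X_α, y]) = (1/2) B(x, y). -/
section Orthonormal

variable {R V ι : Type*} [Field R] [AddCommGroup V] [Module R V] [Fintype ι] [DecidableEq ι]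
  {B : LinearMap.BilinForm R V} {v : ι → V} {c : R}

theorem linearIndependent_of_apply_eq_ite (hc : c ≠ 0)
    (hv : ∀ i j, B (v i) (v j) = if i = j then c else 0) : LinearIndependent R v := by
  rw [Fintype.linearIndependent_iff]
  intro g hg i
  have h := congrArg (B (v i)) hg
  simpa [map_sum, hv, hc] using h

theorem sum_smul_eq_of_mem_span (hc : c ≠ 0)
    (hv : ∀ i j, B (v i) (v j) = if i = j then c else 0) {w : V}
    (hw : w ∈ Submodule.span R (Set.range v)) : ∑ i, (c⁻¹ * B (v i) w) • v i = w := by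
  obtain ⟨g, rfl⟩ := (Submodule.mem_span_range_iff_exists_fun R).mp hw
  refine Finset.sum_congr rfl fun i _ => ?_
  simp [map_sum, hv, mul_comm (g i), hc]

theorem apply_eq_sum_mul_of_mem_span (hc : c ≠ 0)
    (hv : ∀ i j, B (v i) (v j) = if i = j then c else 0) {w : V}
    (hw : w ∈ Submodule.span R (Set.range v)) (u : V) :
    B u w = ∑ i, c⁻¹ * B (v i) w * B u (v i) := by
  conv_lhs => rw [← sum_smul_eq_of_mem_span hc hv hw]
  simp [map_sum]

/-- The trace of an endomorphism preserving both summands of a direct sum, in terms of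
orthogonal bases of the summands. -/
theorem trace_eq_sum_add_sum_of_isCompl {κ : Type*} [Fintype κ] [DecidableEq κ] {w : κ → V} {d : R}
    (hc : c ≠ 0) (hd : d ≠ 0)
    (hv : ∀ i j, B (v i) (v j) = if i = j then c else 0)
    (hw : ∀ i j, B (w i) (w j) = if i = j then d else 0)
    (hvw : IsCompl (Submodule.span R (Set.range v)) (Submodule.span R (Set.range w)))
    (T : V →ₗ[R] V) (hTv : ∀ i, T (v i) ∈ Submodule.span R (Set.range v))
    (hTw : ∀ i, T (w i) ∈ Submodule.span R (Set.range w)) :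
    LinearMap.trace R V T =
      ∑ i, c⁻¹ * B (v i) (T (v i)) + ∑ j, d⁻¹ * B (w j) (T (w j)) := by
  have hli : LinearIndependent R (Sum.elim v w) :=
    (linearIndependent_of_apply_eq_ite hc hv).sum_type
      (linearIndependent_of_apply_eq_ite hd hw) hvw.disjoint
  have hspan : ⊤ ≤ Submodule.span R (Set.range (Sum.elim v w)) := by
    rw [Set.Sum.elim_range, Submodule.span_union, hvw.sup_eq_top]
  let b := Module.Basis.mk hli hspan
  have hbv (i : ι) : v i = b (Sum.inl i) := by simp [b]
  have hbw (j : κ) : w j = b (Sum.inr j) := by simp [b]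
  rw [LinearMap.trace_eq_matrix_trace R b, Matrix.trace, Fintype.sum_sum_type]
  congr 1 <;> refine Finset.sum_congr rfl fun i _ => ?_
  · rw [Matrix.diag_apply, LinearMap.toMatrix_apply, ← hbv]
    conv_lhs => rw [← sum_smul_eq_of_mem_span hc hv (hTv i)]
    simp_rw [map_sum, map_smul, hbv, Module.Basis.repr_self]
    simp [Finsupp.single_apply]
  · rw [Matrix.diag_apply, LinearMap.toMatrix_apply, ← hbw]
    conv_lhs => rw [← sum_smul_eq_of_mem_span hd hw (hTw i)]
    simp_rw [map_sum, map_smul, hbw, Module.Basis.repr_self]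
    simp [Finsupp.single_apply]

end Orthonormal

theorem killingForm_lie_left {R L : Type*} [CommRing R] [LieRing L] [LieAlgebra R L] (x y z : L) :
    killingForm R L ⁅x, y⁆ z = -killingForm R L y ⁅x, z⁆ := by
  rw [← lie_skew x y, map_neg, LinearMap.neg_apply, LieModule.traceForm_apply_lie_apply]

/-- Identity (2.5): for a Cartan-type decomposition `g = k ⊕ m` with Killing-orthonormal
bases `Xm` of `m` (with `B(Xm i, Xm j) = δᵢⱼ`) and `Xk` of `k` (with
`B(Xk α, Xk β) = −δ_{αβ}`), one has `∑ α, B(⁅Xk α, x⁆, ⁅Xk α, y⁆) = (1/2) B(x, y)`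
for all `x, y ∈ m`. -/
theorem sum_killing_bracket_k_eq_half
    (L : Type*) [LieRing L] [LieAlgebra ℝ L] [FiniteDimensional ℝ L]
    (k m : Submodule ℝ L) (hcompl : IsCompl k m)
    (hkk : ∀ x ∈ k, ∀ y ∈ k, ⁅x, y⁆ ∈ k)
    (hmm : ∀ x ∈ m, ∀ y ∈ m, ⁅x, y⁆ ∈ k)
    (hkm : ∀ x ∈ k, ∀ y ∈ m, ⁅x, y⁆ ∈ m)
    (n r : ℕ) (Xm : Fin n → L) (Xk : Fin r → L)
    (hXm_span : Submodule.span ℝ (Set.range Xm) = m)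
    (hXk_span : Submodule.span ℝ (Set.range Xk) = k)
    (hXm_on : ∀ i j, killingForm ℝ L (Xm i) (Xm j) = if i = j then 1 else 0)
    (hXk_on : ∀ α β, killingForm ℝ L (Xk α) (Xk β) = if α = β then -1 else 0)
    (x y : L) (hx : x ∈ m) (hy : y ∈ m) :
    ∑ α : Fin r, killingForm ℝ L ⁅Xk α, x⁆ ⁅Xk α, y⁆
      = (1 / 2 : ℝ) * killingForm ℝ L x y := by
  subst hXm_span hXk_span
  set B := killingForm ℝ L
  have hmem (z : L) (hz : z ∈ Submodule.span ℝ (Set.range Xm)) (α : Fin r) :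
      ⁅z, Xk α⁆ ∈ Submodule.span ℝ (Set.range Xm) := by
    rw [← lie_skew]
    exact neg_mem (hkm _ (Submodule.subset_span ⟨α, rfl⟩) _ hz)
  have hXm (i : Fin n) : Xm i ∈ Submodule.span ℝ (Set.range Xm) := Submodule.subset_span ⟨i, rfl⟩
  have htrace : B x y = ∑ i, B (Xm i) ⁅x, ⁅y, Xm i⁆⁆ - ∑ α, B (Xk α) ⁅x, ⁅y, Xk α⁆⁆ := by
    have h := trace_eq_sum_add_sum_of_isCompl one_ne_zero (neg_ne_zero.mpr one_ne_zero)
      hXm_on hXk_on hcompl.symm (LieAlgebra.ad ℝ L x ∘ₗ LieAlgebra.ad ℝ L y)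
      (fun i => by
        rw [LinearMap.comp_apply, LieAlgebra.ad_apply, LieAlgebra.ad_apply, ← lie_skew]
        exact neg_mem (hkm _ (hmm _ hy _ (hXm i)) _ hx))
      (fun α => hmm _ hx _ (hmem y hy α))
    rw [← killingForm_apply_apply] at h
    simpa [inv_neg, sub_eq_add_neg] using h
  have hm (i : Fin n) : B (Xm i) ⁅x, ⁅y, Xm i⁆⁆ =
      ∑ α, B (Xm i) ⁅x, Xk α⁆ * B (Xm i) ⁅y, Xk α⁆ := by
    rw [← neg_neg (B (Xm i) _), ← killingForm_lie_left,
      apply_eq_sum_mul_of_mem_span (neg_ne_zero.mpr one_ne_zero) hXk_on (hmm _ hy _ (hXm i)),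
      ← Finset.sum_neg_distrib]
    refine Finset.sum_congr rfl fun α _ => ?_
    rw [LieModule.traceForm_comm ℝ L L (Xk α), killingForm_lie_left, killingForm_lie_left]
    ring
  have hswap (α : Fin r) : B ⁅Xk α, x⁆ ⁅Xk α, y⁆ = B ⁅x, Xk α⁆ ⁅y, Xk α⁆ := by
    rw [← lie_skew x, ← lie_skew y]
    simp only [map_neg, LinearMap.neg_apply, neg_neg]
  have hk (α : Fin r) : B (Xk α) ⁅x, ⁅y, Xk α⁆⁆ = -B ⁅Xk α, x⁆ ⁅Xk α, y⁆ := by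
    rw [← neg_neg (B (Xk α) _), ← killingForm_lie_left, hswap]
  have hsum (α : Fin r) : ∑ i, B (Xm i) ⁅x, Xk α⁆ * B (Xm i) ⁅y, Xk α⁆ =
      B ⁅Xk α, x⁆ ⁅Xk α, y⁆ := by
    rw [hswap, apply_eq_sum_mul_of_mem_span one_ne_zero hXm_on (hmem y hy α)]
    refine Finset.sum_congr rfl fun i _ => ?_
    rw [LieModule.traceForm_comm ℝ L L ⁅x, Xk α⁆]
    ring
  simp only [hm, hk, Finset.sum_neg_distrib] at htrace
  rw [Finset.sum_comm, Finset.sum_congr rfl fun α _ => hsum α] at htrace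
  linarith
end

section
/- Let g be a finite-dimensional real Lie algebra with Killing form B, and let g = k ⊕ m be a direct sum decomposition into subspaces satisfying [k,k] ⊆ k, [m,m] ⊆ k, [k,m] ⊆ m. Suppose the restriction of B to m is positive definite, and {X_α} (α = n+1,…,n+r) is a basis of k with B(X_α, X_β) = −δ_{αβ}. Then for every x ∈ m, Σ_α [X_α, [X_α, x]] = −(1/2) x. -/
open LinearMap in
/-- An endomorphism which is off-diagonal with respect to an idempotent has trace zero. -/
lemma trace_eq_zero_of_mul_add_mul_eq {R M : Type*} [CommRing R] [AddCommGroup M] [Module R M]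
    {P A : Module.End R M} (hP : P * P = P) (hA : P * A + A * P = A) : trace R M A = 0 := by
  have hPAP : P * A * P = 0 := by
    have h := congrArg (P * ·) hA
    simpa only [mul_add, ← mul_assoc, hP, add_eq_left] using h
  have hPA : trace R M (P * A) = 0 := by
    rw [← hP, mul_assoc, trace_mul_comm, hPAP, map_zero]
  rw [← hA, map_add, trace_mul_comm R A P, hPA, add_zero]

open LinearMap in
/-- If `A` is off-diagonal with respect to `P`, then the trace of `A * B` is a sum of two traces
of operators factoring through `P`. -/
lemma trace_mul_eq_add_of_mul_add_mul_eq {R M : Type*} [CommRing R] [AddCommGroup M] [Module R M]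
    {P A : Module.End R M} (hA : P * A + A * P = A) (B : Module.End R M) :
    trace R M (A * B) = trace R M (A * B * P) + trace R M (B * A * P) := by
  conv_lhs => rw [← hA]
  rw [add_mul, map_add, mul_assoc, trace_mul_comm R P, mul_assoc A P B, trace_mul_comm R A,
    trace_mul_comm R (P * B) A, ← mul_assoc, trace_mul_comm R (A * P) B, ← mul_assoc]

/-- An endomorphism interchanging two complementary submodules is off-diagonal with respect to
the projection onto the first one. -/
lemma projection_mul_add_mul_projection_eq {R M : Type*} [CommRing R] [AddCommGroup M] [Module R M]
    {p q : Submodule R M} (h : IsCompl p q) {A : Module.End R M}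
    (hpq : ∀ x ∈ p, A x ∈ q) (hqp : ∀ x ∈ q, A x ∈ p) :
    p.projection q h * A + A * p.projection q h = A := by
  ext z
  obtain ⟨a, ha, b, hb, rfl⟩ := Submodule.mem_sup.mp (h.sup_eq_top ▸ Submodule.mem_top : z ∈ p ⊔ q)
  simp [Submodule.projection_apply_of_mem_left h ha, Submodule.projection_apply_of_mem_right h hb,
    Submodule.projection_apply_of_mem_right h (hpq a ha),
    Submodule.projection_apply_of_mem_left h (hqp b hb), add_comm]

/-- Operator form of identity (2.5): for a Cartan-type decomposition `g = k ⊕ m` with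
the Killing form positive definite on `m` and a basis `Xk` of `k` with
`B(Xk α, Xk β) = −δ_{αβ}`, the operator `∑ α (ad Xk α)²` acts as `−1/2` on `m`. -/
theorem sum_bracket_bracket_k_eq_neg_half_smul
    (L : Type*) [LieRing L] [LieAlgebra ℝ L] [FiniteDimensional ℝ L]
    (k m : Submodule ℝ L) (hcompl : IsCompl k m)
    (hkk : ∀ x ∈ k, ∀ y ∈ k, ⁅x, y⁆ ∈ k)
    (hmm : ∀ x ∈ m, ∀ y ∈ m, ⁅x, y⁆ ∈ k)
    (hkm : ∀ x ∈ k, ∀ y ∈ m, ⁅x, y⁆ ∈ m)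
    (hposdef : ∀ x ∈ m, x ≠ 0 → 0 < killingForm ℝ L x x)
    (r : ℕ) (Xk : Fin r → L)
    (hXk_span : Submodule.span ℝ (Set.range Xk) = k)
    (hXk_on : ∀ α β, killingForm ℝ L (Xk α) (Xk β) = if α = β then -1 else 0)
    (x : L) (hx : x ∈ m) :
    ∑ α : Fin r, ⁅Xk α, ⁅Xk α, x⁆⁆ = (-(1 / 2) : ℝ) • x := by
  have hmk : ∀ a ∈ m, ∀ b ∈ k, ⁅a, b⁆ ∈ m := fun a ha b hb => by
    rw [← lie_skew]; exact m.neg_mem (hkm b hb a ha)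
  have hXk : ∀ α, Xk α ∈ k := fun α => hXk_span ▸ Submodule.subset_span ⟨α, rfl⟩
  set P := k.projection m hcompl with hP_def
  have hPk {a : L} (ha : a ∈ k) : P a = a := Submodule.projection_apply_of_mem_left hcompl ha
  have hPm {a : L} (ha : a ∈ m) : P a = 0 := Submodule.projection_apply_of_mem_right hcompl ha
  have hsup (z : L) : ∃ a ∈ k, ∃ b ∈ m, a + b = z :=
    Submodule.mem_sup.mp (hcompl.sup_eq_top ▸ Submodule.mem_top)
  have hPP : P * P = P := by
    ext z
    obtain ⟨a, ha, b, hb, rfl⟩ := hsup z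
    simp [hPk ha, hPm hb]
  have horth : ∀ a ∈ k, ∀ b ∈ m, killingForm ℝ L a b = 0 := fun a ha b hb =>
    trace_eq_zero_of_mul_add_mul_eq hPP <| projection_mul_add_mul_projection_eq hcompl
      (fun z hz => hkm a ha _ (hmk b hb z hz)) (fun z hz => hkk a ha _ (hmm b hb z hz))
  have hP_sum : P = ∑ α, (-killingForm ℝ L (Xk α)).smulRight (Xk α) := by
    have hk : Set.EqOn P (∑ α, (-killingForm ℝ L (Xk α)).smulRight (Xk α) : Module.End ℝ L) k := by
      rw [← hXk_span]
      refine LinearMap.eqOn_span ?_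
      rintro _ ⟨β, rfl⟩
      simp [hPk (hXk β), hXk_on, LinearMap.sum_apply]
    ext z
    obtain ⟨a, ha, b, hb, rfl⟩ := hsup z
    rw [map_add, map_add, hk ha, hPm hb]
    simp [LinearMap.sum_apply, horth _ (hXk _) b hb]
  have htrace (T : Module.End ℝ L) :
      LinearMap.trace ℝ L (T * P) = -∑ α, killingForm ℝ L (Xk α) (T (Xk α)) := by
    rw [LinearMap.trace_mul_comm, hP_sum, Finset.sum_mul, map_sum, ← Finset.sum_neg_distrib]
    refine Finset.sum_congr rfl fun α _ => ?_
    have : (-killingForm ℝ L (Xk α)).smulRight (Xk α) * T =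
        ((-killingForm ℝ L (Xk α)) ∘ₗ T).smulRight (Xk α) := rfl
    rw [this, LinearMap.trace_smulRight]
    rfl
  have hinv (a b c : L) : killingForm ℝ L ⁅a, b⁆ c = -killingForm ℝ L b ⁅a, c⁆ :=
    LieModule.traceForm_apply_lie_apply' ℝ L L a b c
  have hsymm (a b : L) : killingForm ℝ L a b = killingForm ℝ L b a :=
    LieModule.traceForm_comm ℝ L L a b
  have hterm (X a b : L) :
      killingForm ℝ L X ⁅a, ⁅b, X⁆⁆ = killingForm ℝ L ⁅X, ⁅X, a⁆⁆ b := by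
    rw [hinv X, ← lie_skew X a, ← lie_skew X b, map_neg, map_neg, LinearMap.neg_apply, hinv a X]
    simp
  have hswap (X a b : L) :
      killingForm ℝ L ⁅X, ⁅X, a⁆⁆ b = killingForm ℝ L ⁅X, ⁅X, b⁆⁆ a := by
    rw [hinv X ⁅X, a⁆, hinv X ⁅X, b⁆, hsymm]
  have hform (y : L) :
      killingForm ℝ L x y = -2 * killingForm ℝ L (∑ α, ⁅Xk α, ⁅Xk α, x⁆⁆) y := by
    have h := trace_mul_eq_add_of_mul_add_mul_eq (projection_mul_add_mul_projection_eq hcompl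
      (A := LieAlgebra.ad ℝ L x) (hmk x hx) (hmm x hx)) (LieAlgebra.ad ℝ L y)
    rw [← hP_def, htrace, htrace] at h
    simp only [Module.End.mul_apply, LieAlgebra.ad_apply, hterm, hswap _ y x] at h
    rw [map_sum, LinearMap.sum_apply]
    refine Eq.trans h ?_
    ring
  have hS : ∑ α, ⁅Xk α, ⁅Xk α, x⁆⁆ ∈ m :=
    m.sum_mem fun α _ => hkm _ (hXk α) _ (hkm _ (hXk α) x hx)
  set S := ∑ α, ⁅Xk α, ⁅Xk α, x⁆⁆
  have hD : S + (1 / 2 : ℝ) • x = 0 := by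
    by_contra hne
    refine (hposdef _ (m.add_mem hS (m.smul_mem _ hx)) hne).ne' ?_
    rw [LinearMap.map_add₂, LinearMap.map_smul₂, hform, smul_eq_mul]
    ring
  rw [neg_smul]
  exact eq_neg_of_add_eq_zero_left hD
end

section
/- Let E be a real inner product space of finite dimension n ≥ 3, u ∈ E a unit vector, and A : E → E a symmetric (self-adjoint) linear map with A(u) = 0, such that ⟨A v, v⟩ ≥ ‖v‖² for every v orthogonal to u, and trace A − 2⟨A v, v⟩ ≥ 0 for every unit vector v orthogonal to u. Then for every ω ∈ E, with S(v) = (1/2)‖ω‖² v − ⟨v, ω⟩ ω and T(v) = ⟨v, u⟩ u + A(v), one has trace(S ∘ T) ≥ (1/2)‖ω‖². -/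
open RealInnerProductSpace

section

variable {E : Type*} [NormedAddCommGroup E] [InnerProductSpace ℝ E]

theorem inner_sub_inner_smul_self {u : E} (hu : ‖u‖ = 1) (v : E) :
    ⟪v - ⟪v, u⟫ • u, u⟫ = 0 := by
  rw [inner_sub_left, real_inner_smul_left, real_inner_self_eq_norm_sq, hu]
  ring

theorem norm_sq_sub_inner_smul {u : E} (hu : ‖u‖ = 1) (v : E) :
    ‖v - ⟪v, u⟫ • u‖ ^ 2 = ‖v‖ ^ 2 - ⟪v, u⟫ ^ 2 := by
  rw [norm_sub_sq_real, real_inner_smul_right, norm_smul, hu, mul_one, Real.norm_eq_abs, sq_abs]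
  ring

/-- The quadratic form of a symmetric map killing `u` only sees the part orthogonal to `u`. -/
theorem LinearMap.IsSymmetric.inner_map_sub_smul {A : E →ₗ[ℝ] E} (hA : A.IsSymmetric) {u : E}
    (hAu : A u = 0) (v : E) (c : ℝ) : ⟪A (v - c • u), v - c • u⟫ = ⟪A v, v⟫ := by
  rw [map_sub, map_smul, hAu, smul_zero, sub_zero, inner_sub_right, real_inner_smul_right,
    hA v u, hAu, inner_zero_right, mul_zero, sub_zero]

/-- A bound on the quadratic form over unit vectors of `uᗮ` extends by homogeneity. -/
theorem inner_map_le_mul_norm_sq_of_unit {A : E →ₗ[ℝ] E} {u : E} {c : ℝ}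
    (h : ∀ v : E, ⟪v, u⟫ = 0 → ‖v‖ = 1 → ⟪A v, v⟫ ≤ c) {w : E} (hw : ⟪w, u⟫ = 0) :
    ⟪A w, w⟫ ≤ c * ‖w‖ ^ 2 := by
  rcases eq_or_ne w 0 with rfl | hw0
  · simp
  have hn : ‖w‖ ≠ 0 := norm_ne_zero_iff.mpr hw0
  have key := h (‖w‖⁻¹ • w) (by rw [real_inner_smul_left, hw, mul_zero])
    (by rw [norm_smul, norm_inv, norm_norm, inv_mul_cancel₀ hn])
  rw [map_smul, real_inner_smul_left, real_inner_smul_right] at key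
  have hmul := mul_le_mul_of_nonneg_right key (sq_nonneg ‖w‖)
  field_simp at hmul
  linarith

variable [FiniteDimensional ℝ E]

/-- A map vanishing at the unit vector `u` and bounded below by the identity on `uᗮ` has trace
at least `dim E - 1`. -/
theorem finrank_sub_one_le_trace {A : E →ₗ[ℝ] E} (hA : A.IsSymmetric) {u : E} (hu : ‖u‖ = 1)
    (hAu : A u = 0) (h : ∀ v : E, ⟪v, u⟫ = 0 → ‖v‖ ^ 2 ≤ ⟪A v, v⟫) :
    (Module.finrank ℝ E : ℝ) - 1 ≤ LinearMap.trace ℝ E A := by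
  let b := stdOrthonormalBasis ℝ E
  have hb (i) : 1 ≤ ⟪b i, A (b i)⟫ + ⟪u, b i⟫ * ⟪b i, u⟫ := by
    have hi := h _ (inner_sub_inner_smul_self hu (b i))
    rw [norm_sq_sub_inner_smul hu, hA.inner_map_sub_smul hAu, b.orthonormal.1 i] at hi
    rw [real_inner_comm (b i) u, real_inner_comm (A (b i)) (b i)]
    linarith
  have hsum := Finset.sum_le_sum fun i (_ : i ∈ Finset.univ) => hb i
  rw [Finset.sum_add_distrib, b.sum_inner_mul_inner, ← LinearMap.trace_eq_sum_inner A b,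
    real_inner_self_eq_norm_sq, hu] at hsum
  simp only [Finset.sum_const, Finset.card_univ, Fintype.card_fin, nsmul_eq_mul] at hsum
  linarith

theorem trace_smul_sub_inner_smul_comp (c : ℝ) (ω : E) {S T : E →ₗ[ℝ] E}
    (hS : ∀ v, S v = c • v - ⟪v, ω⟫ • ω) (hT : T.IsSymmetric) :
    LinearMap.trace ℝ E (S ∘ₗ T) = c * LinearMap.trace ℝ E T - ⟪T ω, ω⟫ := by
  let b := stdOrthonormalBasis ℝ E
  rw [LinearMap.trace_eq_sum_inner _ b, LinearMap.trace_eq_sum_inner T b, Finset.mul_sum,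
    ← b.sum_inner_mul_inner (T ω) ω, ← Finset.sum_sub_distrib]
  refine Finset.sum_congr rfl fun i _ => ?_
  rw [LinearMap.comp_apply, hS, inner_sub_right, real_inner_smul_right, real_inner_smul_right,
    hT (b i) ω, real_inner_comm (T ω) (b i)]

theorem trace_inner_smul_add {u : E} {A T : E →ₗ[ℝ] E} (hT : ∀ v, T v = ⟪v, u⟫ • u + A v) :
    LinearMap.trace ℝ E T = ‖u‖ ^ 2 + LinearMap.trace ℝ E A := by
  let b := stdOrthonormalBasis ℝ E
  rw [LinearMap.trace_eq_sum_inner T b, LinearMap.trace_eq_sum_inner A b,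
    ← real_inner_self_eq_norm_sq, ← b.sum_inner_mul_inner u u, ← Finset.sum_add_distrib]
  refine Finset.sum_congr rfl fun i _ => ?_
  rw [hT, inner_add_right, real_inner_smul_right, real_inner_comm u (b i)]

end

/-- The pointwise coercivity estimate of Section 3: if `dim E = n ≥ 3`, `u` is a unit
vector, `A` is symmetric with `A u = 0`, `⟪A v, v⟫ ≥ ‖v‖²` for all `v ⟂ u`, and
`trace A − 2⟪A v, v⟫ ≥ 0` for all unit `v ⟂ u`, then for every `ω`, with
`S v = (1/2)‖ω‖² v − ⟪v, ω⟫ ω` and `T v = ⟪v, u⟫ u + A v`, one has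
`trace (S ∘ T) ≥ (1/2)‖ω‖²`. -/
theorem trace_stress_energy_comp_ge
    (E : Type*) [NormedAddCommGroup E] [InnerProductSpace ℝ E] [FiniteDimensional ℝ E]
    (hdim : 3 ≤ Module.finrank ℝ E)
    (u : E) (hu : ‖u‖ = 1)
    (A : E →ₗ[ℝ] E) (hA : LinearMap.IsSymmetric A) (hAu : A u = 0)
    (hA_lower : ∀ v : E, ⟪v, u⟫ = 0 → ⟪A v, v⟫ ≥ ‖v‖ ^ 2)
    (hA_trace : ∀ v : E, ⟪v, u⟫ = 0 → ‖v‖ = 1 →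
      LinearMap.trace ℝ E A - 2 * ⟪A v, v⟫ ≥ 0)
    (ω : E)
    (S T : E →ₗ[ℝ] E)
    (hS : ∀ v, S v = ((1 / 2 : ℝ) * ‖ω‖ ^ 2) • v - ⟪v, ω⟫ • ω)
    (hT : ∀ v, T v = ⟪v, u⟫ • u + A v) :
    LinearMap.trace ℝ E (S ∘ₗ T) ≥ (1 / 2 : ℝ) * ‖ω‖ ^ 2 := by
  have hTsymm : T.IsSymmetric := fun x y => by
    rw [hT, hT, inner_add_left, inner_add_right, real_inner_smul_left, real_inner_smul_right,
      hA x y, real_inner_comm y u]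
    ring
  have htrace := finrank_sub_one_le_trace hA hu hAu hA_lower
  have hdim' : (3 : ℝ) ≤ Module.finrank ℝ E := by exact_mod_cast hdim
  have hupper := inner_map_le_mul_norm_sq_of_unit (A := A) (c := LinearMap.trace ℝ E A / 2)
    (fun v hv hv1 => by linarith [hA_trace v hv hv1]) (inner_sub_inner_smul_self hu ω)
  rw [hA.inner_map_sub_smul hAu, norm_sq_sub_inner_smul hu] at hupper
  rw [trace_smul_sub_inner_smul_comp _ ω hS hTsymm, trace_inner_smul_add hT, hu, hT,
    inner_add_left, real_inner_smul_left, real_inner_comm ω u]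
  nlinarith [mul_nonneg (sq_nonneg ⟪ω, u⟫)
    (by linarith : 0 ≤ LinearMap.trace ℝ E A - 2)]
end
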